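/- Let L be a finitely generated R-module such that L ⊗_R K = 0. Then Tor_i^R(L, K) = 0 for every i ≥ 0, where K is regarded as an R-module via φ. -/

import Mathlib

open CategoryTheory
open scoped TensorProduct

/-- The ring homomorphism `φ : 𝔽_p[y_t : t ∈ σ] → 𝔽_p[v, v⁻¹]` sending the distinguished
variable `y_s` to `v` and every other variable to `0`. -/
noncomputable def moravaPhi (p : ℕ) {σ : Type} [DecidableEq σ] (s : σ) :
    MvPolynomial σ (ZMod p) →+* LaurentPolynomial (ZMod p) :=
  (MvPolynomial.aeval fun t => if t = s then LaurentPolynomial.T 1 else 0).toRingHom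

/-- The left derived functors of an additive functor are additive. -/
theorem leftDerived_additive {C D : Type*} [Category* C] [Category* D] [Abelian C] [Abelian D]
    [HasProjectiveResolutions C] (F : C ⥤ D) [F.Additive] (n : ℕ) :
    (F.leftDerived n).Additive where
  map_add {X Y f g} := by
    let P := projectiveResolution X
    let Q := projectiveResolution Y
    have hw : (ProjectiveResolution.lift f P Q + ProjectiveResolution.lift g P Q) ≫ Q.π =
        P.π ≫ (ChainComplex.single₀ C).map (f + g) := by
      have : (ChainComplex.single₀ C).Additive :=
        inferInstanceAs (HomologicalComplex.single C (.down ℕ) 0).Additive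
      simp only [Preadditive.add_comp, ProjectiveResolution.lift_commutes, Functor.map_add,
        Preadditive.comp_add]
    rw [F.leftDerived_map_eq n (f + g) _ hw,
      F.leftDerived_map_eq n f _ (ProjectiveResolution.lift_commutes f P Q),
      F.leftDerived_map_eq n g _ (ProjectiveResolution.lift_commutes g P Q),
      Functor.map_add, Preadditive.add_comp, Preadditive.comp_add]

open MonoidalCategory in
/-- If `r` annihilates `M`, then multiplication by `r` on `N` induces zero on `Tor_i(M, N)`. -/
theorem tor_map_smul_id_eq_zero {R : Type} [CommRing R] (M N : ModuleCat.{0} R) {r : R}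
    (hr : r ∈ Module.annihilator R M) (i : ℕ) :
    ((Tor (ModuleCat R) i).obj M).map (r • 𝟙 N) = 0 := by
  let P := projectiveResolution N
  have hw : (r • 𝟙 P.complex) ≫ P.π =
      P.π ≫ (ChainComplex.single₀ (ModuleCat R)).map (r • 𝟙 N) := by
    refine HomologicalComplex.to_single_hom_ext ?_
    ext x
    exact map_smul (P.π.f 0).hom r x
  have hz : (((tensoringLeft (ModuleCat R)).obj M).mapHomologicalComplex _).map
      (r • 𝟙 P.complex) = 0 := by
    ext j : 1
    refine ModuleCat.MonoidalCategory.tensor_ext fun m n => ?_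
    change m ⊗ₜ[R] (r • n) = 0
    rw [← TensorProduct.smul_tmul, Module.mem_annihilator.mp hr, TensorProduct.zero_tmul]
  rw [Tor_obj, Functor.leftDerived_map_eq _ i _ (r • 𝟙 P.complex) hw, Functor.comp_map, hz,
    Functor.map_zero]
  exact (congrArg (_ ≫ ·) Limits.zero_comp).trans Limits.comp_zero

/-- A finite module whose base change to `S` vanishes has an annihilator generating the unit
ideal of `S`. -/
theorem Ideal.map_annihilator_eq_top_of_subsingleton_tensorProduct {R S M : Type*} [CommRing R]
    [CommRing S] [Algebra R S] [AddCommGroup M] [Module R M] [Module.Finite R M]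
    [Subsingleton (S ⊗[R] M)] :
    (Module.annihilator R M).map (algebraMap R S) = ⊤ := by
  by_contra h
  obtain ⟨m, hm, hle⟩ := Ideal.exists_le_maximal _ h
  let q : PrimeSpectrum R := ⟨m.comap (algebraMap R S), inferInstance⟩
  have hq : q ∈ Module.support R M := by
    rw [Module.support_eq_zeroLocus]
    exact Ideal.map_le_iff_le_comap.mp hle
  rw [Module.mem_support_iff_nontrivial_residueField_tensorProduct] at hq
  let f : q.asIdeal.ResidueField →ₐ[R] m.ResidueField :=
    Ideal.ResidueField.mapₐ q.asIdeal m (Algebra.ofId R S) rfl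
  let _ : Algebra q.asIdeal.ResidueField m.ResidueField := f.toAlgebra
  have : IsScalarTower R q.asIdeal.ResidueField m.ResidueField :=
    .of_algebraMap_eq' f.comp_algebraMap.symm
  have e₁ := TensorProduct.AlgebraTensorModule.cancelBaseChange R q.asIdeal.ResidueField
    q.asIdeal.ResidueField m.ResidueField M
  have e₂ := TensorProduct.AlgebraTensorModule.cancelBaseChange R S S m.ResidueField M
  have h₁ : Nontrivial (m.ResidueField ⊗[q.asIdeal.ResidueField]
      (q.asIdeal.ResidueField ⊗[R] M)) :=
    (Module.FaithfullyFlat.nontrivial_tensorProduct_iff_right _ _).mpr hq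
  have h₂ : Subsingleton (m.ResidueField ⊗[R] M) := e₂.symm.subsingleton
  exact not_subsingleton _ e₁.subsingleton

/-- If `M` is a finite `R`-module and `M ⊗ S = 0` for an `R`-algebra `S`, then all
`Tor_i(M, S)` vanish. -/
theorem tor_isZero_of_subsingleton_tensorProduct {R S M : Type} [CommRing R]
    [CommRing S] [Algebra R S] [AddCommGroup M] [Module R M] [Module.Finite R M]
    [Subsingleton (M ⊗[R] S)] (i : ℕ) :
    Limits.IsZero (((Tor (ModuleCat R) i).obj (ModuleCat.of R M)).obj (ModuleCat.of R S)) := by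
  have : Subsingleton (S ⊗[R] M) := (TensorProduct.comm R S M).subsingleton
  let F := (Tor (ModuleCat R) i).obj (ModuleCat.of R M)
  have hadd : F.Additive := by
    exact leftDerived_additive _ i
  let mulHom (s : S) : ModuleCat.of R S ⟶ ModuleCat.of R S :=
    ModuleCat.ofHom (LinearMap.mulLeft R s)
  have mulHom_add (s t : S) : mulHom (s + t) = mulHom s + mulHom t := by
    ext x
    exact add_mul s t x
  have mulHom_mul (s t : S) : mulHom (s * t) = mulHom t ≫ mulHom s := by
    ext x
    exact mul_assoc s t x
  have key (s : S) (hs : s ∈ (Module.annihilator R M).map (algebraMap R S)) :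
      F.map (mulHom s) = 0 := by
    refine Submodule.span_induction ?_ ?_ ?_ ?_ hs
    · rintro _ ⟨r, hr, rfl⟩
      have : mulHom (algebraMap R S r) = r • 𝟙 (ModuleCat.of R S) := by
        ext x
        exact (Algebra.smul_def r x).symm
      rw [this]
      exact tor_map_smul_id_eq_zero (ModuleCat.of R M) _ hr i
    · have : mulHom 0 = 0 := by
        ext x
        exact zero_mul x
      rw [this, F.map_zero]
    · intro s t _ _ hs ht
      rw [mulHom_add, F.map_add, hs, ht, add_zero]
    · intro s t _ ht
      rw [smul_eq_mul, mulHom_mul, F.map_comp, ht, Limits.zero_comp]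
  have hone : mulHom 1 = 𝟙 _ := by
    ext x
    exact one_mul x
  rw [Limits.IsZero.iff_id_eq_zero, ← CategoryTheory.Functor.map_id, ← hone]
  refine key 1 ?_
  rw [Ideal.map_annihilator_eq_top_of_subsingleton_tensorProduct]
  trivial

/-- If `L` is a finitely generated module over `R = 𝔽_p[y_t : t ∈ σ]` with
`L ⊗_R K = 0`, where `K = 𝔽_p[v, v⁻¹]` is regarded as an `R`-module via `φ = moravaPhi`,
then `Tor_i^R(L, K) = 0` for every `i ≥ 0`. -/
theorem tor_isZero_of_tensor_subsingleton
    (p : ℕ) [Fact p.Prime] (σ : Type) [DecidableEq σ] (s : σ)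
    (L : Type) [AddCommGroup L] [Module (MvPolynomial σ (ZMod p)) L]
    [Module.Finite (MvPolynomial σ (ZMod p)) L] :
    let _ : Algebra (MvPolynomial σ (ZMod p)) (LaurentPolynomial (ZMod p)) :=
      (moravaPhi p s).toAlgebra
    Subsingleton (L ⊗[MvPolynomial σ (ZMod p)] LaurentPolynomial (ZMod p)) →
      ∀ i : ℕ,
        Limits.IsZero
          (((Tor (ModuleCat (MvPolynomial σ (ZMod p))) i).obj
              (ModuleCat.of (MvPolynomial σ (ZMod p)) L)).obj
            (ModuleCat.of (MvPolynomial σ (ZMod p)) (LaurentPolynomial (ZMod p)))) := by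
  intro _ _ i
  exact tor_isZero_of_subsingleton_tensorProduct i
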